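/- Let K_n denote the number of vectors v ∈ (ZMod 2)^n for which the n×n tridiagonal matrix T(v) over ZMod 2 (diagonal entries v_i, entries 1 on the sub- and super-diagonal, 0 elsewhere) is invertible. Then K_1 = 1 and, for all n ≥ 2, K_n = 2^n − K_{n−1}. -/

import Mathlib

/-- The adjacency matrix of the path graph on `n` vertices over `ZMod 2`. -/
def pathAdj (n : ℕ) : Matrix (Fin n) (Fin n) (ZMod 2) :=
  Matrix.of fun i j => if (i : ℕ) + 1 = (j : ℕ) ∨ (j : ℕ) + 1 = (i : ℕ) then 1 else 0

/-- The tridiagonal matrix with diagonal `v` and `1` on the sub- and super-diagonal. -/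
def triDiag (n : ℕ) (v : Fin n → ZMod 2) : Matrix (Fin n) (Fin n) (ZMod 2) :=
  Matrix.of fun i j => if i = j then v i else pathAdj n i j

theorem triDiag_tail (n : ℕ) (v : Fin (n + 1) → ZMod 2) :
    (triDiag (n + 1) v).submatrix Fin.succ Fin.succ = triDiag n (Fin.tail v) := by
  ext i j
  simp [triDiag, pathAdj, Fin.tail]

theorem det_rec (n : ℕ) (v : Fin (n + 2) → ZMod 2) :
    (triDiag (n + 2) v).det
      = v 0 * (triDiag (n + 1) (Fin.tail v)).det
        + (triDiag n (Fin.tail (Fin.tail v))).det := by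
  rw [Matrix.det_succ_row_zero, Fin.sum_univ_succ, Fin.sum_univ_succ]
  have h0 : ∀ i : Fin n, triDiag (n + 2) v 0 i.succ.succ = 0 := by
    intro i
    have : (0 : Fin (n + 2)) ≠ i.succ.succ := (Fin.succ_ne_zero _).symm
    simp [triDiag, pathAdj, this]
  have h1 : triDiag (n + 2) v 0 (Fin.succ 0) = 1 := by
    simp [triDiag, pathAdj]
  have h00 : triDiag (n + 2) v 0 0 = v 0 := by simp [triDiag]
  have hm : (-1 : ZMod 2) = 1 := by decide
  have hs : Fin.succAbove (0 : Fin (n + 2)) = Fin.succ := by ext i; simp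
  have hdet : ((triDiag (n + 2) v).submatrix Fin.succ (Fin.succAbove (Fin.succ 0))).det
      = (triDiag n (Fin.tail (Fin.tail v))).det := by
    rw [Matrix.det_succ_column_zero, Fin.sum_univ_succ]
    have e0 : ∀ i : Fin n,
        (triDiag (n + 2) v).submatrix Fin.succ (Fin.succAbove (Fin.succ 0)) i.succ 0 = 0 := by
      intro i
      simp [triDiag, pathAdj]
    have e1 : (triDiag (n + 2) v).submatrix Fin.succ (Fin.succAbove (Fin.succ 0)) 0 0 = 1 := by
      simp [triDiag, pathAdj]
    have e2 : ((triDiag (n + 2) v).submatrix Fin.succ (Fin.succAbove (Fin.succ 0))).submatrix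
        (Fin.succAbove 0) Fin.succ = triDiag n (Fin.tail (Fin.tail v)) := by
      rw [← triDiag_tail, ← triDiag_tail]
      ext i j
      simp [Matrix.submatrix_apply]
    simp only [e0, e1, e2]
    simp
  simp only [h0, h1, h00, hdet, hs, triDiag_tail, hm]
  simp

theorem det_tail (n : ℕ) (w : Fin (n + 1) → ZMod 2) (h : (triDiag (n + 1) w).det = 0) :
    (triDiag n (Fin.tail w)).det = 1 := by
  induction n with
  | zero => simp
  | succ n ih =>
    by_contra h1
    have h2 : (triDiag (n + 1) (Fin.tail w)).det = 0 := by
      generalize (triDiag (n + 1) (Fin.tail w)).det = x at h1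
      revert x; decide
    have h3 := ih _ h2
    rw [det_rec, h2, h3] at h
    simp at h

def cnt (n : ℕ) : ℤ := ∑ v : Fin n → ZMod 2, if (triDiag n v).det = 1 then 1 else 0

theorem card_eq_cnt (n : ℕ) :
    (Nat.card {v : Fin n → ZMod 2 // IsUnit (triDiag n v)} : ℤ) = cnt n := by
  classical
  have hu : ∀ x : ZMod 2, IsUnit x ↔ x = 1 := by
    intro x; rw [isUnit_iff_ne_zero]; revert x; decide
  simp only [Matrix.isUnit_iff_isUnit_det, hu]
  rw [Nat.card_eq_fintype_card, Fintype.card_subtype, cnt]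
  simp

theorem cnt_rec (n : ℕ) : cnt (n + 2) = 2 ^ (n + 2) - cnt (n + 1) := by
  have e : cnt (n + 2) = ∑ w : Fin (n + 1) → ZMod 2,
      (2 - if (triDiag (n + 1) w).det = 1 then 1 else 0) := by
    rw [cnt, ← (Fin.consEquiv (fun _ : Fin (n + 2) => ZMod 2)).sum_comp, Fintype.sum_prod_type,
      Finset.sum_comm]
    refine Finset.sum_congr rfl fun w _ => ?_
    have h := det_tail n w
    simp only [Fin.consEquiv, Equiv.coe_fn_mk, det_rec, Fin.tail_cons, Fin.cons_zero]
    generalize (triDiag (n + 1) w).det = x at *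
    generalize (triDiag n (Fin.tail w)).det = y at *
    revert x y
    decide
  rw [e, Finset.sum_sub_distrib, ← cnt]
  simp [pow_succ]

theorem stmt1 (K : ℕ → ℕ)
    (hK : ∀ n, K n = Nat.card {v : Fin n → ZMod 2 // IsUnit (triDiag n v)}) :
    K 1 = 1 ∧ ∀ n, 2 ≤ n → (K n : ℤ) = 2 ^ n - K (n - 1) := by
  have hc : ∀ n, (K n : ℤ) = cnt n := fun n => by rw [hK, card_eq_cnt]
  constructor
  · have : cnt 1 = 1 := by
      simp only [cnt, Matrix.det_fin_one]
      decide
    have h := hc 1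
    rw [this] at h
    exact_mod_cast h
  · intro n hn
    obtain ⟨m, rfl⟩ := Nat.exists_eq_add_of_le' hn
    rw [hc, hc, cnt_rec]
    rfl
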